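/- Let μ be a non-self-dual irreducible element of ℤ[H] (i.e. μ ≁ μ̄). Then the assignment p·Q(H)^{sym} ↦ e_μ(p) − e_{μ̄}(p) is a well-defined surjective group homomorphism Θ_μ from Q(H)^×/Q(H)^{sym} onto ℤ. (Proposition 5.1(2), well-definedness and surjectivity.) -/

import Mathlib

noncomputable section
open scoped nonZeroDivisors

/-- `H = H₁(Σ_{g,n}) ≅ ℤ^{n-1+2g}`, written as `H_∂ × Ĥ` with `Ĥ` carrying the
symplectic structure (two `Fin g` blocks). -/
abbrev SurfH (g n : ℕ) : Type := (Fin (n - 1) → ℤ) × ((Fin g → ℤ) × (Fin g → ℤ))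

/-- The integral group ring `ℤ[H]`. -/
abbrev GR (g n : ℕ) : Type := AddMonoidAlgebra ℤ (SurfH g n)

instance (g n : ℕ) : IsDomain (GR g n) := NoZeroDivisors.to_isDomain _

/-- The quotient field `Q(H)` of `ℤ[H]`. -/
abbrev QF (g n : ℕ) : Type := FractionRing (GR g n)

/-- The inclusion `ℤ[H] → Q(H)`. -/
abbrev incl (g n : ℕ) : GR g n →+* QF g n := algebraMap (GR g n) (QF g n)

/-- The standard symplectic form on `Ĥ = ℤ^{2g}`. -/
def symplForm {g : ℕ} (v w : (Fin g → ℤ) × (Fin g → ℤ)) : ℤ :=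
  (∑ i, v.1 i * w.2 i) - ∑ i, v.2 i * w.1 i

/-- `Aut*(H)`: automorphisms of `H` fixing `H_∂` pointwise and with block form
`[[I, *], [0, P₀]]`, `P₀ ∈ Sp(2g, ℤ)`. -/
def AutStar (g n : ℕ) : Set (SurfH g n ≃+ SurfH g n) :=
  {φ | (∀ x : Fin (n - 1) → ℤ, φ (x, 0) = (x, 0)) ∧
       ∀ v w : (Fin g → ℤ) × (Fin g → ℤ),
         symplForm (φ (0, v)).2 (φ (0, w)).2 = symplForm v w}

/-- The ring automorphism of `ℤ[H]` induced by an automorphism of `H`. -/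
def ringAut {g n : ℕ} (φ : SurfH g n ≃+ SurfH g n) : GR g n ≃+* GR g n :=
  (AddMonoidAlgebra.domCongr ℤ ℤ φ).toRingEquiv

/-- The field automorphism of `Q(H)` induced by a ring automorphism of `ℤ[H]`. -/
def fieldAut {g n : ℕ} (e : GR g n ≃+* GR g n) : QF g n ≃+* QF g n :=
  IsFractionRing.ringEquivOfRingEquiv e

/-- The involution `p ↦ p̄` of `ℤ[H]`, induced by `h ↦ h⁻¹`. -/
def barR (g n : ℕ) : GR g n ≃+* GR g n := ringAut (AddEquiv.neg (SurfH g n))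

/-- The involution `p ↦ p̄` of `Q(H)`. -/
def barQ (g n : ℕ) : QF g n ≃+* QF g n := fieldAut (barR g n)

/-- `p ≐ q`: `p = ±h·q` for some `h ∈ H`. -/
def doteq {g n : ℕ} (p q : QF g n) : Prop :=
  ∃ (u : ℤˣ) (h : SurfH g n), p = incl g n (AddMonoidAlgebra.single h (u : ℤ)) * q

/-- `p ∼ q`: `p ≐ φ(q)` for some `φ ∈ Aut*(H)`. -/
def sim (g n : ℕ) (p q : QF g n) : Prop :=
  ∃ φ ∈ AutStar g n, doteq p (fieldAut (ringAut φ) q)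

/-- The subgroup `A(H)` of `Q(H)^×` generated by all `±h·p⁻¹·φ(p)`. -/
def AH (g n : ℕ) : Subgroup (QF g n)ˣ :=
  Subgroup.closure {x : (QF g n)ˣ |
    ∃ (u : ℤˣ) (h : SurfH g n) (p : (QF g n)ˣ) (φ : SurfH g n ≃+ SurfH g n),
      φ ∈ AutStar g n ∧
      (x : QF g n) = incl g n (AddMonoidAlgebra.single h (u : ℤ)) * (↑p)⁻¹ *
        fieldAut (ringAut φ) ↑p}

/-- The subgroup `N(H) = {±h·q·q̄}` of `Q(H)^×`. -/
def NH (g n : ℕ) : Subgroup (QF g n)ˣ :=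
  Subgroup.closure {x : (QF g n)ˣ |
    ∃ (u : ℤˣ) (h : SurfH g n) (q : (QF g n)ˣ),
      (x : QF g n) = incl g n (AddMonoidAlgebra.single h (u : ℤ)) * ↑q * barQ g n ↑q}

/-- The involution on `Q(H)^×` as a group homomorphism. -/
def barU (g n : ℕ) : (QF g n)ˣ →* (QF g n)ˣ :=
  Units.map (barQ g n).toRingHom.toMonoidHom

/-- `Q(H)^{sym} = {p : p·A(H) = p̄·A(H)}`. -/
def Qsym (g n : ℕ) : Subgroup (QF g n)ˣ :=
  (AH g n).comap (barU g n / MonoidHom.id (QF g n)ˣ)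

open UniqueFactorizationMonoid in
/-- For irreducible `l`, the number of irreducible factors (with multiplicity) of
`r ∈ ℤ[H]` lying in the `∼`-class of `l`; this is `e_l` on `ℤ[H]`. -/
def eCount (g n : ℕ) [UniqueFactorizationMonoid (GR g n)] (l r : GR g n) : ℕ :=
  Multiset.card (@Multiset.filter _
    (fun m => sim g n (incl g n m) (incl g n l)) (Classical.decPred _) (factors r))

/-- `e_l(p)` for `p ∈ Q(H)^×`, via a choice of fraction representation. -/
def eOrb (g n : ℕ) [UniqueFactorizationMonoid (GR g n)] (l : GR g n) (p : QF g n) : ℤ :=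
  (eCount g n l (IsLocalization.sec (GR g n)⁰ p).1 : ℤ) -
    (eCount g n l ((IsLocalization.sec (GR g n)⁰ p).2 : GR g n) : ℤ)

/-- The units of an integral group ring over a torsion-free abelian group (more generally, over
a group with two unique sums) are the trivial ones. -/
theorem AddMonoidAlgebra.exists_eq_single_of_isUnit {A : Type*} [AddCommGroup A]
    [TwoUniqueSums A] {a : AddMonoidAlgebra ℤ A} (ha : IsUnit a) :
    ∃ (u : ℤˣ) (h : A), a = AddMonoidAlgebra.single h (u : ℤ) := by
  classical
  obtain ⟨b, hab⟩ := ha.exists_right_inv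
  have hone : (1 : AddMonoidAlgebra ℤ A) = AddMonoidAlgebra.single 0 1 := rfl
  have hcoeff : ∀ x, x ≠ 0 → (a * b).coeff x = 0 := fun x hx => by
    rw [hab, hone, AddMonoidAlgebra.coeff_single, Finsupp.single_apply, if_neg hx.symm]
  have ha0 : a ≠ 0 := by
    rintro rfl
    have := congrArg (fun f : AddMonoidAlgebra ℤ A => f.coeff 0) hab
    simp [hone] at this
  have hb0 : b ≠ 0 := by
    rintro rfl
    have := congrArg (fun f : AddMonoidAlgebra ℤ A => f.coeff 0) hab
    simp [hone] at this
  have hsa : a.coeff.support.Nonempty := by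
    rw [Finsupp.support_nonempty_iff]
    simpa using ha0
  have hsb : b.coeff.support.Nonempty := by
    rw [Finsupp.support_nonempty_iff]
    simpa using hb0
  have hcard : a.coeff.support.card * b.coeff.support.card ≤ 1 := by
    by_contra! hlt
    obtain ⟨p, hp, q, hq, hpq, hup, huq⟩ := TwoUniqueSums.uniqueAdd_of_one_lt_card hlt
    have key : ∀ r ∈ a.coeff.support ×ˢ b.coeff.support,
        UniqueAdd a.coeff.support b.coeff.support r.1 r.2 → r.1 + r.2 = 0 := by
      intro r hr hu
      by_contra hne
      have h0 := hcoeff _ hne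
      rw [AddMonoidAlgebra.coeff_mul_add_of_uniqueAdd hu] at h0
      rw [Finset.mem_product, Finsupp.mem_support_iff, Finsupp.mem_support_iff] at hr
      exact mul_ne_zero hr.1 hr.2 h0
    have hmem := Finset.mem_product.mp hq
    have h := hup hmem.1 hmem.2 ((key q hq huq).trans (key p hp hup).symm)
    exact hpq (Prod.ext h.1.symm h.2.symm)
  have hca : a.coeff.support.card = 1 := by
    have h1 := hsa.card_pos
    have h2 := hsb.card_pos
    nlinarith
  have hcb : b.coeff.support.card = 1 := by
    have h1 := hsa.card_pos
    have h2 := hsb.card_pos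
    nlinarith
  obtain ⟨x, c, -, hx⟩ := Finsupp.card_support_eq_one'.mp hca
  obtain ⟨y, d, -, hy⟩ := Finsupp.card_support_eq_one'.mp hcb
  have hax : a = AddMonoidAlgebra.single x c := AddMonoidAlgebra.coeff_injective hx
  have hby : b = AddMonoidAlgebra.single y d := AddMonoidAlgebra.coeff_injective hy
  have hcd : c * d = 1 := by
    rw [hax, hby, AddMonoidAlgebra.single_mul_single, hone] at hab
    have := congrArg (fun f : AddMonoidAlgebra ℤ A => f.coeff (x + y)) hab
    simp only [AddMonoidAlgebra.coeff_single, Finsupp.single_apply, if_true] at this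
    split_ifs at this
    · exact this
    · exact absurd (this ▸ rfl : c * d = 0) fun h0 => by
        have := congrArg (fun f : AddMonoidAlgebra ℤ A => f.coeff 0) hab
        rw [h0] at this
        simp at this
  exact ⟨Units.mkOfMulEqOne c d hcd, x, hax⟩

theorem AddMonoidAlgebra.isUnit_single {A : Type*} [AddCommGroup A] (u : ℤˣ) (h : A) :
    IsUnit (AddMonoidAlgebra.single h (u : ℤ)) := by
  refine IsUnit.of_mul_eq_one (AddMonoidAlgebra.single (-h) ((u⁻¹ : ℤˣ) : ℤ)) ?_
  rw [AddMonoidAlgebra.single_mul_single, add_neg_cancel, ← Units.val_mul, mul_inv_cancel]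
  rfl

section Factors

open UniqueFactorizationMonoid

theorem Multiset.Rel.card_filter_eq {α : Type*} {r : α → α → Prop} {P Q : α → Prop}
    [DecidablePred P] [DecidablePred Q] {s t : Multiset α} (h : Multiset.Rel r s t)
    (hPQ : ∀ a b, r a b → (P a ↔ Q b)) :
    Multiset.card (s.filter P) = Multiset.card (t.filter Q) := by
  induction h with
  | zero => rfl
  | @cons a b s t hab _ ih =>
    by_cases hP : P a
    · rw [Multiset.filter_cons_of_pos _ hP, Multiset.filter_cons_of_pos _ ((hPQ a b hab).mp hP),
        Multiset.card_cons, Multiset.card_cons, ih]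
    · rw [Multiset.filter_cons_of_neg _ hP,
        Multiset.filter_cons_of_neg _ fun hQ => hP ((hPQ a b hab).mpr hQ), ih]

theorem UniqueFactorizationMonoid.rel_factors_map {R : Type*} [CommRing R] [IsDomain R]
    [UniqueFactorizationMonoid R] (e : R ≃+* R) {r : R} (hr : r ≠ 0) :
    Multiset.Rel (fun m k => Associated (e m) k) (factors r) (factors (e r)) := by
  have h : Multiset.Rel Associated ((factors r).map e) (factors (e r)) := by
    refine factors_unique (fun x hx => ?_) irreducible_of_factor ?_
    · obtain ⟨y, hy, rfl⟩ := Multiset.mem_map.mp hx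
      exact (MulEquiv.irreducible_iff e).mpr (irreducible_of_factor y hy)
    · rw [Multiset.prod_hom]
      exact ((factors_prod hr).map e).trans
        (factors_prod ((map_ne_zero_iff e e.injective).mpr hr)).symm
  exact Multiset.rel_map_left.mp h

end Factors

section Surface

variable {g n : ℕ}

theorem autStar_snd_apply {φ : SurfH g n ≃+ SurfH g n} (hφ : φ ∈ AutStar g n) (h : SurfH g n) :
    (φ h).2 = (φ (0, h.2)).2 := by
  have : h = (h.1, 0) + (0, h.2) := by simp
  conv_lhs => rw [this, map_add, hφ.1]
  simp

theorem autStar_trans {φ ψ : SurfH g n ≃+ SurfH g n} (hφ : φ ∈ AutStar g n)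
    (hψ : ψ ∈ AutStar g n) : φ.trans ψ ∈ AutStar g n := by
  refine ⟨fun x => ?_, fun v w => ?_⟩
  · rw [AddEquiv.trans_apply, hφ.1, hψ.1]
  · rw [AddEquiv.trans_apply, AddEquiv.trans_apply, autStar_snd_apply hψ (φ (0, v)),
      autStar_snd_apply hψ (φ (0, w)), hψ.2, hφ.2]

theorem autStar_symm {φ : SurfH g n ≃+ SurfH g n} (hφ : φ ∈ AutStar g n) :
    φ.symm ∈ AutStar g n := by
  refine ⟨fun x => ?_, fun v w => ?_⟩
  · rw [AddEquiv.symm_apply_eq, hφ.1]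
  · rw [← hφ.2, ← autStar_snd_apply hφ, ← autStar_snd_apply hφ, AddEquiv.apply_symm_apply,
      AddEquiv.apply_symm_apply]

theorem autStar_refl : AddEquiv.refl (SurfH g n) ∈ AutStar g n :=
  ⟨fun _ => rfl, fun _ _ => rfl⟩

theorem ringAut_single (φ : SurfH g n ≃+ SurfH g n) (h : SurfH g n) (c : ℤ) :
    ringAut φ (AddMonoidAlgebra.single h c) = AddMonoidAlgebra.single (φ h) c :=
  AddMonoidAlgebra.domCongr_single (R := ℤ) φ h c

theorem ringAut_trans (φ ψ : SurfH g n ≃+ SurfH g n) (r : GR g n) :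
    ringAut (φ.trans ψ) r = ringAut ψ (ringAut φ r) := by
  have h : ((ringAut (φ.trans ψ) : GR g n ≃+* GR g n) : GR g n →+* GR g n) =
      ((ringAut ψ : GR g n ≃+* GR g n) : GR g n →+* GR g n).comp
        ((ringAut φ : GR g n ≃+* GR g n) : GR g n →+* GR g n) := by
    refine AddMonoidAlgebra.ringHom_ext (fun c => ?_) (fun h => ?_) <;>
      simp [ringAut_single]
  exact RingHom.congr_fun h r

theorem ringAut_refl (r : GR g n) : ringAut (AddEquiv.refl (SurfH g n)) r = r := by
  have h : ((ringAut (AddEquiv.refl (SurfH g n)) : GR g n ≃+* GR g n) : GR g n →+* GR g n) =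
      RingHom.id _ := by
    refine AddMonoidAlgebra.ringHom_ext (fun c => ?_) (fun h => ?_) <;>
      simp [ringAut_single]
  exact RingHom.congr_fun h r

theorem ringAut_symm_apply (φ : SurfH g n ≃+ SurfH g n) (r : GR g n) :
    ringAut φ.symm (ringAut φ r) = r := by
  rw [← ringAut_trans, AddEquiv.self_trans_symm, ringAut_refl]

theorem barR_ringAut (φ : SurfH g n ≃+ SurfH g n) (r : GR g n) :
    barR g n (ringAut φ r) = ringAut φ (barR g n r) := by
  rw [barR, ← ringAut_trans, ← ringAut_trans]
  congr 2
  ext1 h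
  simp

theorem barR_barR (r : GR g n) : barR g n (barR g n r) = r := by
  rw [barR, ← ringAut_trans]
  convert ringAut_refl r
  ext1 h
  simp

theorem fieldAut_incl (e : GR g n ≃+* GR g n) (r : GR g n) :
    fieldAut e (incl g n r) = incl g n (e r) :=
  IsFractionRing.ringEquivOfRingEquiv_algebraMap e r

/-- On `ℤ[H]`, the relation `∼` is association up to the action of `Aut*(H)`. -/
theorem sim_incl_iff {m l : GR g n} :
    sim g n (incl g n m) (incl g n l) ↔ ∃ φ ∈ AutStar g n, Associated m (ringAut φ l) := by
  refine exists_congr fun φ => and_congr_right fun _ => ?_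
  simp only [doteq, fieldAut_incl]
  constructor
  · rintro ⟨u, h, huh⟩
    rw [← map_mul] at huh
    rw [IsFractionRing.injective (GR g n) (QF g n) huh]
    exact associated_unit_mul_left _ _ (AddMonoidAlgebra.isUnit_single u h)
  · intro has
    obtain ⟨v, hv⟩ := has.symm
    obtain ⟨u, h, huh⟩ := AddMonoidAlgebra.exists_eq_single_of_isUnit v.isUnit
    exact ⟨u, h, by rw [← map_mul, ← huh, ← hv, mul_comm]⟩

theorem sim_incl_congr {m m' : GR g n} (h : Associated m m') (l : GR g n) :
    sim g n (incl g n m) (incl g n l) ↔ sim g n (incl g n m') (incl g n l) := by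
  simp only [sim_incl_iff]
  exact exists_congr fun φ => and_congr_right fun _ => ⟨h.symm.trans, h.trans⟩

theorem sim_incl_ringAut {φ : SurfH g n ≃+ SurfH g n} (hφ : φ ∈ AutStar g n) (m l : GR g n) :
    sim g n (incl g n (ringAut φ m)) (incl g n l) ↔ sim g n (incl g n m) (incl g n l) := by
  simp only [sim_incl_iff]
  constructor
  · rintro ⟨ψ, hψ, h⟩
    refine ⟨ψ.trans φ.symm, autStar_trans hψ (autStar_symm hφ), ?_⟩
    have := h.map (ringAut φ.symm)
    rwa [ringAut_symm_apply, ← ringAut_trans] at this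
  · rintro ⟨ψ, hψ, h⟩
    refine ⟨ψ.trans φ, autStar_trans hψ hφ, ?_⟩
    rw [ringAut_trans]
    exact h.map (ringAut φ)

theorem sim_incl_barR (m l : GR g n) :
    sim g n (incl g n (barR g n m)) (incl g n l) ↔
      sim g n (incl g n m) (incl g n (barR g n l)) := by
  simp only [sim_incl_iff]
  refine exists_congr fun φ => and_congr_right fun _ => ⟨fun h => ?_, fun h => ?_⟩
  · have := h.map (barR g n)
    rwa [barR_barR, barR_ringAut] at this
  · have := h.map (barR g n)
    rwa [barR_ringAut, barR_barR] at this

theorem exists_frac {p : QF g n} (hp : p ≠ 0) :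
    ∃ a b : GR g n, a ≠ 0 ∧ b ≠ 0 ∧ p * incl g n b = incl g n a := by
  obtain ⟨⟨a, b⟩, h⟩ := IsLocalization.surj (GR g n)⁰ p
  have hb : (b : GR g n) ≠ 0 := nonZeroDivisors.ne_zero b.2
  refine ⟨a, b, ?_, hb, h⟩
  rintro rfl
  rw [map_zero] at h
  exact mul_ne_zero hp (IsFractionRing.to_map_ne_zero_of_mem_nonZeroDivisors b.2) h

variable [UniqueFactorizationMonoid (GR g n)]

open UniqueFactorizationMonoid

theorem eCount_mul (l : GR g n) {a b : GR g n} (ha : a ≠ 0) (hb : b ≠ 0) :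
    eCount g n l (a * b) = eCount g n l a + eCount g n l b := by
  classical
  unfold eCount
  rw [← Multiset.card_add, ← Multiset.filter_add]
  exact (factors_mul ha hb).card_filter_eq fun m k h => sim_incl_congr h l

theorem eCount_ringEquiv (e : GR g n ≃+* GR g n) {l l' : GR g n}
    (he : ∀ m, sim g n (incl g n (e m)) (incl g n l) ↔ sim g n (incl g n m) (incl g n l'))
    {r : GR g n} (hr : r ≠ 0) : eCount g n l (e r) = eCount g n l' r := by
  classical
  exact ((rel_factors_map e hr).card_filter_eq fun m k h =>
    (he m).symm.trans (sim_incl_congr h l)).symm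

theorem eCount_of_isUnit (l : GR g n) {r : GR g n} (hr : IsUnit r) : eCount g n l r = 0 := by
  have h1 := eCount_mul l (one_ne_zero (α := GR g n)) (one_ne_zero (α := GR g n))
  obtain ⟨s, hs⟩ := hr.exists_right_inv
  have h2 := eCount_mul l hr.ne_zero (right_ne_zero_of_mul_eq_one hs)
  rw [hs] at h2
  rw [mul_one] at h1
  omega

theorem eCount_of_irreducible (l : GR g n) {m : GR g n} (hm : Irreducible m)
    [Decidable (sim g n (incl g n m) (incl g n l))] :
    eCount g n l m = if sim g n (incl g n m) (incl g n l) then 1 else 0 := by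
  obtain ⟨k, hk, hfac⟩ := factors_eq_singleton_of_irreducible hm
  unfold eCount
  rw [hfac, Multiset.filter_singleton]
  simp only [← sim_incl_congr hk l]
  split_ifs <;> rfl

/-- `e_l` may be computed from any representation as a fraction. -/
theorem eOrb_eq (l : GR g n) {p : QF g n} {a b : GR g n} (ha : a ≠ 0) (hb : b ≠ 0)
    (h : p * incl g n b = incl g n a) :
    eOrb g n l p = (eCount g n l a : ℤ) - eCount g n l b := by
  have hinj := IsFractionRing.injective (GR g n) (QF g n)
  have hspec := IsLocalization.sec_spec (GR g n)⁰ p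
  have hd := nonZeroDivisors.ne_zero (IsLocalization.sec (GR g n)⁰ p).2.2
  unfold eOrb
  generalize (IsLocalization.sec (GR g n)⁰ p).1 = c at *
  generalize ((IsLocalization.sec (GR g n)⁰ p).2 : GR g n) = d at *
  have hcross : c * b = a * d := by
    apply hinj
    rw [map_mul, map_mul, ← hspec, ← h]
    ring
  have hc : c ≠ 0 := left_ne_zero_of_mul (hcross ▸ mul_ne_zero ha hd)
  have := congrArg (eCount g n l) hcross
  rw [eCount_mul l hc hb, eCount_mul l ha hd] at this
  omega

theorem eOrb_incl (l : GR g n) {a : GR g n} (ha : a ≠ 0) :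
    eOrb g n l (incl g n a) = eCount g n l a := by
  rw [eOrb_eq l ha one_ne_zero (by rw [map_one, mul_one]), eCount_of_isUnit l isUnit_one]
  simp

theorem eOrb_mul (l : GR g n) {p q : QF g n} (hp : p ≠ 0) (hq : q ≠ 0) :
    eOrb g n l (p * q) = eOrb g n l p + eOrb g n l q := by
  obtain ⟨a, b, ha, hb, hab⟩ := exists_frac hp
  obtain ⟨c, d, hc, hd, hcd⟩ := exists_frac hq
  rw [eOrb_eq l ha hb hab, eOrb_eq l hc hd hcd,
    eOrb_eq l (mul_ne_zero ha hc) (mul_ne_zero hb hd)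
      (by rw [map_mul, map_mul, ← hab, ← hcd]; ring),
    eCount_mul l ha hc, eCount_mul l hb hd]
  push_cast
  ring

theorem eOrb_fieldAut (e : GR g n ≃+* GR g n) {l l' : GR g n}
    (he : ∀ m, sim g n (incl g n (e m)) (incl g n l) ↔ sim g n (incl g n m) (incl g n l'))
    {p : QF g n} (hp : p ≠ 0) : eOrb g n l (fieldAut e p) = eOrb g n l' p := by
  obtain ⟨a, b, ha, hb, hab⟩ := exists_frac hp
  rw [eOrb_eq l' ha hb hab, ← eCount_ringEquiv e he ha, ← eCount_ringEquiv e he hb]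
  refine eOrb_eq l ((map_ne_zero_iff e e.injective).mpr ha)
    ((map_ne_zero_iff e e.injective).mpr hb) ?_
  rw [← fieldAut_incl, ← map_mul, hab, fieldAut_incl]

/-- `e_l` as a group homomorphism on `Q(H)^×`. -/
def eHom (l : GR g n) : (QF g n)ˣ →* Multiplicative ℤ :=
  MonoidHom.mk' (fun p => Multiplicative.ofAdd (eOrb g n l (p : QF g n))) fun p q => by
    rw [Units.val_mul, eOrb_mul l p.ne_zero q.ne_zero, ofAdd_add]

theorem eHom_apply (l : GR g n) (p : (QF g n)ˣ) :
    eHom l p = Multiplicative.ofAdd (eOrb g n l (p : QF g n)) := rfl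

theorem AH_le_ker_eHom (l : GR g n) : AH g n ≤ (eHom l).ker := by
  refine (Subgroup.closure_le _).mpr ?_
  rintro x ⟨u, h, p, φ, hφ, hx⟩
  have hunit := AddMonoidAlgebra.isUnit_single u h
  have hp : fieldAut (ringAut φ) (p : QF g n) ≠ 0 :=
    (map_ne_zero_iff _ (fieldAut (ringAut φ)).injective).mpr p.ne_zero
  have hs : incl g n (AddMonoidAlgebra.single h (u : ℤ)) ≠ 0 := (hunit.map (incl g n)).ne_zero
  have hinv := congrArg Multiplicative.toAdd ((eHom l).map_inv p)
  rw [eHom_apply, eHom_apply, Units.val_inv_eq_inv_val, toAdd_ofAdd, toAdd_inv,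
    toAdd_ofAdd] at hinv
  rw [SetLike.mem_coe, MonoidHom.mem_ker, eHom_apply, hx,
    eOrb_mul l (mul_ne_zero hs (inv_ne_zero p.ne_zero)) hp,
    eOrb_mul l hs (inv_ne_zero p.ne_zero), eOrb_incl l hunit.ne_zero, eCount_of_isUnit l hunit,
    hinv, eOrb_fieldAut _ (fun m => sim_incl_ringAut hφ m l) p.ne_zero]
  simp

theorem eHom_barU (l : GR g n) (p : (QF g n)ˣ) :
    eHom l (barU g n p) = eHom (barR g n l) p :=
  congrArg Multiplicative.ofAdd
    (eOrb_fieldAut (barR g n) (fun m => sim_incl_barR m l) p.ne_zero)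

theorem Qsym_le_ker (l : GR g n) : Qsym g n ≤ (eHom l / eHom (barR g n l)).ker := by
  intro p hp
  have h := AH_le_ker_eHom l hp
  rw [MonoidHom.mem_ker, MonoidHom.div_apply, map_div, eHom_barU, MonoidHom.id_apply,
    div_eq_one] at h
  rw [MonoidHom.mem_ker, MonoidHom.div_apply, h, div_self']

end Surface

/-- **Proposition 5.1 (2), well-definedness and surjectivity of `Θ_μ`.**
If `μ ∈ ℤ[H]` is a non-self-dual irreducible element, then
`p·Q(H)^{sym} ↦ e_μ(p) − e_{μ̄}(p)` is a well-defined surjective group homomorphism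
`Q(H)^×/Q(H)^{sym} → ℤ`. -/
theorem torsion_theta_mu_well_defined_surjective
    (g n : ℕ) (hH : 1 ≤ (n - 1) + 2 * g)
    [UniqueFactorizationMonoid (GR g n)]
    (μ : GR g n) (hirr : Irreducible μ)
    (hnsd : ¬ sim g n (incl g n μ) (incl g n (barR g n μ))) :
    ∃ Θ : (QF g n)ˣ ⧸ Qsym g n →* Multiplicative ℤ,
      Function.Surjective Θ ∧
      ∀ p : (QF g n)ˣ,
        Θ (QuotientGroup.mk p) =
          Multiplicative.ofAdd
            (eOrb g n μ (p : QF g n) - eOrb g n (barR g n μ) (p : QF g n)) := by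
  classical
  refine ⟨QuotientGroup.lift (Qsym g n) (eHom μ / eHom (barR g n μ)) (Qsym_le_ker μ), ?_,
    fun p => rfl⟩
  have hμ : eOrb g n μ (incl g n μ) = 1 := by
    rw [eOrb_incl μ hirr.ne_zero, eCount_of_irreducible μ hirr, if_pos, Nat.cast_one]
    exact sim_incl_iff.mpr ⟨AddEquiv.refl _, autStar_refl, by rw [ringAut_refl]⟩
  have hμ' : eOrb g n (barR g n μ) (incl g n μ) = 0 := by
    rw [eOrb_incl _ hirr.ne_zero, eCount_of_irreducible _ hirr, if_neg hnsd, Nat.cast_zero]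
  have hne : incl g n μ ≠ 0 :=
    (map_ne_zero_iff _ (IsFractionRing.injective (GR g n) (QF g n))).mpr hirr.ne_zero
  intro k
  refine ⟨QuotientGroup.mk (Units.mk0 _ hne ^ k.toAdd), ?_⟩
  rw [QuotientGroup.lift_mk, map_zpow, MonoidHom.div_apply, eHom_apply, eHom_apply,
    Units.val_mk0, hμ, hμ', ofAdd_zero, div_one, ← ofAdd_zsmul, smul_eq_mul, mul_one,
    ofAdd_toAdd]
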